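/- Let (V, ‖·‖) be a b-dimensional real Banach space, and let ‖·‖_E be the Euclidean norm determined by the John ellipsoid of the unit ball of ‖·‖. Then there exist N ≤ b(b+1)/2, reals λ_1,…,λ_N > 0 with Σ_{i=1}^N λ_i = b, and linear functionals L_1,…,L_N : V → ℝ with ‖L_i‖* = 1 (where ‖·‖* is the norm dual to ‖·‖), such that ‖x‖_E² = Σ_{i=1}^N λ_i L_i(x)² for all x ∈ V. -/

import Mathlib

open MeasureTheory Matrix

/-- The `k`-dimensional Riemannian volume of a subset `S` of a Riemannian manifold `X`,
interpreted as the `k`-dimensional Hausdorff measure of `S` with respect to the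
Riemannian distance on `X`. -/
noncomputable def hausdorffVol (X : Type) [MetricSpace X] (k : ℕ) (S : Set X) : ℝ :=
  letI : MeasurableSpace X := borel X
  haveI : BorelSpace X := ⟨rfl⟩
  (μH[(k : ℝ)] S).toReal

/-- The Euclidean norm of a vector in `ℝ^b`. -/
noncomputable def euclNorm {b : ℕ} (v : Fin b → ℝ) : ℝ :=
  Real.sqrt (∑ i, v i ^ 2)

/-- `λ₁` of the lattice in `ℝ^b` spanned over `ℤ` by the columns of an invertible matrix
`M`: the least Euclidean length of a nonzero lattice vector. -/
noncomputable def latticeLambda1 {b : ℕ} (M : Matrix (Fin b) (Fin b) ℝ) : ℝ :=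
  sInf { r : ℝ | ∃ x : Fin b → ℤ, x ≠ 0 ∧ r = euclNorm (M.mulVec (fun i => (x i : ℝ))) }

/-- `hermitePow b = (γ_b)^{b/2}` where `γ_b` is the Hermite constant, defined by
`(γ_b)^{b/2} = sup_L λ₁(L)^b / vol(ℝ^b/L)`, the supremum being taken over all lattices
`L ⊂ ℝ^b`.  A lattice is encoded by an invertible matrix `M` whose columns form a
`ℤ`-basis of it; its covolume `vol(ℝ^b/L)` is then `|det M|`. -/
noncomputable def hermitePow (b : ℕ) : ℝ :=
  sSup { r : ℝ | ∃ M : Matrix (Fin b) (Fin b) ℝ, M.det ≠ 0 ∧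
    r = latticeLambda1 M ^ b / |M.det| }

/-- A lattice in `ℝ^b` (encoded by an invertible matrix `M` whose columns form a
`ℤ`-basis of it) is critical if it attains the supremum defining the Hermite
constant, i.e. if `λ₁(L)^b / vol(ℝ^b/L) = (γ_b)^{b/2}`. -/
def IsCriticalLattice {b : ℕ} (M : Matrix (Fin b) (Fin b) ℝ) : Prop :=
  M.det ≠ 0 ∧ latticeLambda1 M ^ b / |M.det| = hermitePow b

/-- The lattice in `ℝ^b` spanned over `ℤ` by the columns of a matrix `A`: the image of
`ℤ^b` under the linear map with matrix `A`. -/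
noncomputable def latticeOf {b : ℕ} (A : Matrix (Fin b) (Fin b) ℝ) :
    AddSubgroup (Fin b → ℝ) :=
  ((Matrix.mulVecLin A).toAddMonoidHom.comp
    { toFun := fun x i => ((x i : ℤ) : ℝ)
      map_zero' := by funext i; simp
      map_add' := by intro x y; funext i; push_cast; simp } :
        (Fin b → ℤ) →+ (Fin b → ℝ)).range

/-- The Euclidean norm on `ℝ^b` determined by a positive definite symmetric matrix `Q`,
`x ↦ √(xᵀ Q x)`. -/
noncomputable def johnNorm {b : ℕ} (Q : Matrix (Fin b) (Fin b) ℝ) (x : Fin b → ℝ) : ℝ :=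
  Real.sqrt (x ⬝ᵥ Q.mulVec x)

/-- `IsJohnMatrix nrm Q` asserts that the ellipsoid `{x | xᵀ Q x ≤ 1}` is the John
ellipsoid of the unit ball of the norm `nrm` on `ℝ^b`: among all ellipsoids (given by
positive definite symmetric matrices) contained in the unit ball of `nrm`, it has
maximal volume, i.e. minimal determinant.  The associated Euclidean norm `‖·‖_E` is
`johnNorm Q`. -/
def IsJohnMatrix {b : ℕ} (nrm : (Fin b → ℝ) → ℝ) (Q : Matrix (Fin b) (Fin b) ℝ) : Prop :=
  Q.IsSymm ∧ (∀ x : Fin b → ℝ, x ≠ 0 → 0 < x ⬝ᵥ Q.mulVec x) ∧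
  (∀ x : Fin b → ℝ, x ⬝ᵥ Q.mulVec x ≤ 1 → nrm x ≤ 1) ∧
  ∀ Q' : Matrix (Fin b) (Fin b) ℝ, Q'.IsSymm →
    (∀ x : Fin b → ℝ, x ≠ 0 → 0 < x ⬝ᵥ Q'.mulVec x) →
    (∀ x : Fin b → ℝ, x ⬝ᵥ Q'.mulVec x ≤ 1 → nrm x ≤ 1) → Q.det ≤ Q'.det

/-- A continuous map `f : X → Y` induces an epimorphism of fundamental groups:
every loop in `Y` based at `f x₀` is path-homotopic to the image of a loop in `X`
based at `x₀`. -/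
def InducesPi1Surjection {X Y : Type} [TopologicalSpace X] [TopologicalSpace Y]
    (f : C(X, Y)) : Prop :=
  ∀ (x₀ : X) (γ : Path (f x₀) (f x₀)), ∃ δ : Path x₀ x₀,
    (δ.map f.continuous).Homotopic γ

/-- The dual norm of a linear functional `L` on `ℝ^b` with respect to a norm `nrm`:
`‖L‖* = sup { |L x| : nrm x ≤ 1 }`. -/
noncomputable def dualNorm {b : ℕ} (nrm : (Fin b → ℝ) → ℝ)
    (L : (Fin b → ℝ) →ₗ[ℝ] ℝ) : ℝ :=
  sSup { r : ℝ | ∃ x : Fin b → ℝ, nrm x ≤ 1 ∧ r = |L x| }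

open Filter Topology in
/-- In a finite-dimensional real vector space, the convex hull of a compact set is compact. -/
theorem IsCompact.convexHull_of_finiteDimensional {E : Type*} [AddCommGroup E] [Module ℝ E]
    [TopologicalSpace E] [ContinuousAdd E] [ContinuousSMul ℝ E] [FiniteDimensional ℝ E]
    {s : Set E} (hs : IsCompact s) : IsCompact (convexHull ℝ s) := by
  have key : convexHull ℝ s = ⋃ n ∈ Set.Iic (Module.finrank ℝ E + 1),
      (fun p : (Fin n → ℝ) × (Fin n → E) => ∑ i, p.1 i • p.2 i) ''
        (stdSimplex ℝ (Fin n) ×ˢ Set.univ.pi fun _ => s) := by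
    apply Set.Subset.antisymm
    · intro x hx
      obtain ⟨ι, _, z, w, hz, hzi, hw, hw1, rfl⟩ := eq_pos_convex_span_of_mem_convexHull hx
      have hcard : Fintype.card ι ≤ Module.finrank ℝ E + 1 :=
        hzi.card_le_finrank_succ.trans (Nat.succ_le_succ (Submodule.finrank_le _))
      let e := (Fintype.equivFin ι).symm
      simp only [Set.mem_iUnion]
      refine ⟨Fintype.card ι, hcard, (w ∘ e, z ∘ e), ⟨⟨fun i => (hw _).le, ?_⟩, ?_⟩, ?_⟩
      · rw [← hw1]; exact e.sum_comp w
      · exact fun i _ => hz ⟨_, rfl⟩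
      · exact e.sum_comp fun i => w i • z i
    · simp only [Set.iUnion_subset_iff]
      rintro n - _ ⟨⟨w, z⟩, ⟨hw, hz⟩, rfl⟩
      exact (convex_convexHull ℝ s).sum_mem (fun i _ => hw.1 i) hw.2
        fun i _ => subset_convexHull ℝ s (hz i trivial)
  rw [key]
  refine (Set.finite_Iic _).isCompact_biUnion fun n _ => ?_
  refine ((isCompact_stdSimplex ℝ (Fin n)).prod (isCompact_univ_pi fun _ => hs)).image ?_
  fun_prop

/-- A point outside the convex hull of the squares `v vᵀ`, `v ∈ S`, is strictly separated from
them by a symmetric matrix, acting on symmetric matrices through the trace pairing. -/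
theorem exists_isSymm_separating {n : Type*} [Fintype n] [DecidableEq n]
    {S : Set (n → ℝ)} (hS : IsCompact S) {A : Matrix n n ℝ} (hA : A.IsSymm)
    (h : (fun i j => A i j) ∉ convexHull ℝ ((fun (v : n → ℝ) i j => v i * v j) '' S)) :
    ∃ (H : Matrix n n ℝ) (u : ℝ), H.IsSymm ∧ (∀ v ∈ S, v ⬝ᵥ H.mulVec v < u) ∧
      u < (A * H).trace := by
  have hc : IsCompact (convexHull ℝ ((fun (v : n → ℝ) i j => v i * v j) '' S)) :=
    (hS.image (by fun_prop)).convexHull_of_finiteDimensional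
  obtain ⟨f, u, hfu, huf⟩ :=
    geometric_hahn_banach_closed_point (convex_convexHull ℝ _) hc.isClosed h
  let F : n → n → ℝ := fun i j => f (Pi.single i (Pi.single j 1))
  have hf : ∀ B : n → n → ℝ, f B = ∑ i, ∑ j, B i j * F i j := by
    intro B
    have hB : B = ∑ i, ∑ j, B i j • (Pi.single i (Pi.single j 1) : n → n → ℝ) := by
      ext k l
      simp [Finset.sum_apply, Pi.single_apply, ite_apply]
    conv_lhs => rw [hB]
    simp [F]
  have hf' : ∀ B : n → n → ℝ, (∀ i j, B i j = B j i) →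
      f B = ∑ i, ∑ j, B i j * ((F i j + F j i) / 2) := by
    intro B hB
    have h2 : f B = ∑ i, ∑ j, B i j * F j i := by
      rw [hf, Finset.sum_comm]
      exact Finset.sum_congr rfl fun i _ => Finset.sum_congr rfl fun j _ => by rw [hB]
    have h3 : ∑ i, ∑ j, B i j * ((F i j + F j i) / 2)
        = ((∑ i, ∑ j, B i j * F i j) + ∑ i, ∑ j, B i j * F j i) / 2 := by
      simp only [← Finset.sum_add_distrib, Finset.sum_div]
      exact Finset.sum_congr rfl fun i _ => Finset.sum_congr rfl fun j _ => by ring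
    rw [h3, ← hf, ← h2]
    ring
  refine ⟨Matrix.of fun i j => (F i j + F j i) / 2, u, ?_, ?_, ?_⟩
  · ext i j
    simp [add_comm]
  · intro v hv
    refine lt_of_eq_of_lt ?_ (hfu _ (subset_convexHull ℝ _ ⟨v, hv, rfl⟩))
    rw [hf' _ fun i j => mul_comm _ _]
    simp only [dotProduct, Matrix.mulVec, Matrix.of_apply, Finset.mul_sum]
    exact Finset.sum_congr rfl fun i _ => Finset.sum_congr rfl fun j _ => by ring
  · refine huf.trans_eq ?_
    rw [hf' _ fun i j => (hA.apply j i)]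
    simp only [Matrix.trace, Matrix.diag, Matrix.mul_apply, Matrix.of_apply]
    exact Finset.sum_congr rfl fun i _ => Finset.sum_congr rfl fun j _ => by ring

open Filter Topology in
/-- The determinant increases strictly in a direction whose logarithmic derivative is positive. -/
theorem eventually_det_lt_det_add_smul {n : Type*} [Fintype n] [DecidableEq n]
    {P Q H : Matrix n n ℝ} (hPQ : P * Q = 1) (hP : 0 < P.det) (hH : 0 < (Q * H).trace) :
    ∀ᶠ ε : ℝ in 𝓝[>] 0, P.det < (P + ε • H).det := by
  obtain ⟨p, hp⟩ : ∃ p : Polynomial ℝ, ∀ r : ℝ,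
      (1 + r • (Q * H)).det = 1 + (Q * H).trace * r + p.eval r * r ^ 2 :=
    ⟨_, fun r => Matrix.det_one_add_smul r _⟩
  have hlim : ∀ᶠ ε : ℝ in 𝓝[>] 0, 0 < (Q * H).trace + p.eval ε * ε := by
    refine Filter.Eventually.filter_mono nhdsWithin_le_nhds ?_
    have hc : Continuous fun ε : ℝ => (Q * H).trace + p.eval ε * ε := by fun_prop
    exact (hc.tendsto 0).eventually (lt_mem_nhds (by simpa using hH))
  filter_upwards [hlim, self_mem_nhdsWithin] with ε hε (hpos : 0 < ε)
  have : P + ε • H = P * (1 + ε • (Q * H)) := by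
    rw [mul_add, mul_one, mul_smul_comm, ← mul_assoc, hPQ, one_mul]
  rw [this, Matrix.det_mul, hp]
  nlinarith [mul_pos hP (mul_pos hpos hε)]

open Filter Topology in
/-- Strict positivity on a compact set is stable under small continuous perturbations. -/
theorem IsCompact.eventually_pos_add_mul {X : Type*} [TopologicalSpace X] {S : Set X}
    (hS : IsCompact S) {p h : X → ℝ} (hp : Continuous p) (hh : Continuous h)
    (hpos : ∀ x ∈ S, 0 < p x) : ∀ᶠ ε : ℝ in 𝓝 0, ∀ x ∈ S, 0 < p x + ε * h x := by
  refine hS.eventually_forall_of_forall_eventually fun x hx => ?_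
  have hc : Continuous fun z : ℝ × X => p z.2 + z.1 * h z.2 := by fun_prop
  exact (hc.tendsto (0, x)).eventually (lt_mem_nhds (by simpa using hpos x hx))

open Filter Topology in
/-- Positive definiteness is stable under small symmetric perturbations. -/
theorem Matrix.PosDef.eventually_add_smul {n : Type*} [Fintype n]
    {P H : Matrix n n ℝ} (hP : P.PosDef) (hH : H.IsSymm) :
    ∀ᶠ ε : ℝ in 𝓝 0, (P + ε • H).PosDef := by
  have key := (isCompact_sphere (0 : n → ℝ) 1).eventually_pos_add_mul
    (p := fun v => v ⬝ᵥ P.mulVec v) (h := fun v => v ⬝ᵥ H.mulVec v)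
    (by fun_prop) (by fun_prop) (fun v hv => by
      have hv0 : v ≠ 0 := fun h => by simp [h] at hv
      simpa using hP.dotProduct_mulVec_pos hv0)
  filter_upwards [key] with ε hε
  refine Matrix.PosDef.of_dotProduct_mulVec_pos ?_ fun {v} hv => ?_
  · have h1 : P.IsSymm := by simpa [Matrix.IsHermitian, Matrix.IsSymm] using hP.isHermitian
    simp [Matrix.IsHermitian, h1.eq, hH.eq]
  · have hn : 0 < ‖v‖ := norm_pos_iff.mpr hv
    have := hε (‖v‖⁻¹ • v) (by simp [norm_smul, hn.ne'])
    simp only [Matrix.mulVec_smul, dotProduct_smul, smul_dotProduct, smul_eq_mul] at this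
    have h2 : 0 < ‖v‖⁻¹ * ‖v‖⁻¹ * (v ⬝ᵥ P.mulVec v + ε * (v ⬝ᵥ H.mulVec v)) := by
      linarith
    simpa [Matrix.add_mulVec, Matrix.smul_mulVec, dotProduct_add] using
      (mul_pos_iff_of_pos_left (by positivity)).mp h2

/-- The polar body of a norm on `ℝᵇ`: the functionals of dual norm at most one. -/
def polarBody {b : ℕ} (nrm : Seminorm ℝ (Fin b → ℝ)) : Set (Fin b → ℝ) :=
  {v | ∀ y, |v ⬝ᵥ y| ≤ nrm y}

theorem isCompact_polarBody {b : ℕ} (nrm : Seminorm ℝ (Fin b → ℝ)) :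
    IsCompact (polarBody nrm) := by
  have hclosed : IsClosed (polarBody nrm) := by
    simp only [polarBody, Set.ofPred_forall]
    exact isClosed_iInter fun y => isClosed_le (by fun_prop) continuous_const
  refine (isCompact_univ_pi fun i : Fin b =>
    isCompact_Icc (a := -nrm (Pi.single i 1)) (b := nrm (Pi.single i 1))).of_isClosed_subset
    hclosed fun v hv i _ => ?_
  simpa using abs_le.mp (hv (Pi.single i 1))

theorem exists_mem_polarBody_dotProduct_eq {b : ℕ} (nrm : Seminorm ℝ (Fin b → ℝ))
    (x : Fin b → ℝ) : ∃ v ∈ polarBody nrm, v ⬝ᵥ x = nrm x := by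
  obtain ⟨g, hgx, hg⟩ : ∃ g : Module.Dual ℝ (Fin b → ℝ), g x = nrm x ∧ ∀ y, |g y| ≤ nrm y := by
    rcases eq_or_ne x 0 with rfl | hx
    · exact ⟨0, by simp, by simp⟩
    let f : (Fin b → ℝ) →ₗ.[ℝ] ℝ := LinearPMap.mkSpanSingleton x (nrm x) hx
    have hf : ∀ y : f.domain, f y ≤ nrm y := by
      rintro ⟨y, hy⟩
      obtain ⟨c, rfl⟩ := Submodule.mem_span_singleton.mp hy
      have : f ⟨c • x, hy⟩ = c * nrm x := LinearPMap.mkSpanSingleton'_apply _ _ _ _ _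
      rw [this]
      simpa [map_smul_eq_mul] using mul_le_mul_of_nonneg_right (le_abs_self c) (apply_nonneg nrm x)
    obtain ⟨g, hgf, hg⟩ := Module.Dual.exists_extension_of_le_seminorm_real f.domain f.toFun hf
    refine ⟨g, ?_, hg⟩
    have := hgf ⟨x, Submodule.mem_span_singleton_self x⟩
    exact this.trans (LinearPMap.mkSpanSingleton_apply ℝ ℝ hx _)
  have hdot : ∀ y, (fun i => g (Pi.single i 1)) ⬝ᵥ y = g y := by
    intro y
    conv_rhs => rw [← LinearMap.sum_single_apply (fun _ => ℝ) y]
    rw [map_sum]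
    refine Finset.sum_congr rfl fun i _ => ?_
    have : (Pi.single i (y i) : Fin b → ℝ) = y i • Pi.single i 1 := by
      simp [← Pi.single_smul]
    simp [this, mul_comm]
  exact ⟨fun i => g (Pi.single i 1), fun y => by rw [hdot]; exact hg y, by rw [hdot, hgx]⟩

/-- An ellipsoid lies in the unit ball of a norm if the polar body lies in the polar ellipsoid. -/
theorem norm_le_one_of_forall_polarBody {b : ℕ} {nrm : Seminorm ℝ (Fin b → ℝ)}
    {P Q : Matrix (Fin b) (Fin b) ℝ} (hP : P.PosDef) (hPQ : P * Q = 1)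
    (h : ∀ v ∈ polarBody nrm, v ⬝ᵥ P.mulVec v ≤ 1) (x : Fin b → ℝ)
    (hx : x ⬝ᵥ Q.mulVec x ≤ 1) : nrm x ≤ 1 := by
  obtain ⟨v, hv, hvx⟩ := exists_mem_polarBody_dotProduct_eq nrm x
  have hPt : Pᵀ = P := by simpa [Matrix.IsHermitian] using hP.isHermitian
  have hPy : P.mulVec (Q.mulVec x) = x := by rw [Matrix.mulVec_mulVec, hPQ, Matrix.one_mulVec]
  have hy : Q.mulVec x ⬝ᵥ P.mulVec v = v ⬝ᵥ x := by
    rw [Matrix.dotProduct_mulVec, ← Matrix.mulVec_transpose, hPt, hPy, dotProduct_comm]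
  have hnn := hP.posSemidef.dotProduct_mulVec_nonneg (v - (v ⬝ᵥ x) • Q.mulVec x)
  simp only [star_trivial, Matrix.mulVec_sub, Matrix.mulVec_smul, hPy, sub_dotProduct,
    dotProduct_sub, smul_dotProduct, dotProduct_smul, hy, smul_eq_mul] at hnn
  rw [dotProduct_comm (Q.mulVec x) x] at hnn
  rw [hvx] at hnn
  have h1 := h v hv
  nlinarith [mul_le_mul_of_nonneg_left hx (sq_nonneg (nrm x))]

/-- If an ellipsoid lies in the unit ball of a norm, then the polar body lies in the polar
ellipsoid. -/
theorem dotProduct_mulVec_le_one_of_mem_polarBody {b : ℕ} {nrm : Seminorm ℝ (Fin b → ℝ)}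
    {P Q : Matrix (Fin b) (Fin b) ℝ} (hPQ : Q * P = 1)
    (h : ∀ x, x ⬝ᵥ Q.mulVec x ≤ 1 → nrm x ≤ 1) {v : Fin b → ℝ} (hv : v ∈ polarBody nrm) :
    v ⬝ᵥ P.mulVec v ≤ 1 := by
  by_contra! hlt
  set t := v ⬝ᵥ P.mulVec v with ht
  have hs : 0 < √t := Real.sqrt_pos.mpr (by linarith)
  have hss : √t * √t = t := Real.mul_self_sqrt (by linarith)
  have h1 : nrm ((√t)⁻¹ • P.mulVec v) ≤ 1 := by
    apply h
    rw [Matrix.mulVec_smul, Matrix.mulVec_mulVec, hPQ, Matrix.one_mulVec, smul_dotProduct,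
      dotProduct_smul, dotProduct_comm, ← ht, smul_eq_mul, smul_eq_mul]
    have : (√t)⁻¹ * ((√t)⁻¹ * t) = 1 := by
      rw [← mul_assoc, ← mul_inv, hss, inv_mul_cancel₀ (by positivity)]
    exact this.le
  have h2 := (le_abs_self _).trans (hv ((√t)⁻¹ • P.mulVec v))
  rw [dotProduct_smul, ← ht, smul_eq_mul] at h2
  have h3 : (√t)⁻¹ * t = √t := by
    rw [inv_mul_eq_iff_eq_mul₀ hs.ne', hss]
  rw [h3] at h2
  nlinarith

/-- A convex combination of squares `v vᵀ` lying on a hyperplane `⟨P, ·⟩ = 1` can be written with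
at most `b (b + 1) / 2` squares. -/
theorem exists_fin_sum_squares_of_mem_convexHull {b : ℕ} {S : Set (Fin b → ℝ)}
    {A P : Matrix (Fin b) (Fin b) ℝ} (hS : ∀ v ∈ S, v ⬝ᵥ P.mulVec v = 1)
    (h : (fun i j => A i j) ∈ convexHull ℝ ((fun (v : Fin b → ℝ) i j => v i * v j) '' S)) :
    ∃ N ≤ b * (b + 1) / 2, ∃ (w : Fin N → ℝ) (v : Fin N → Fin b → ℝ),
      (∀ k, 0 < w k) ∧ ∑ k, w k = 1 ∧ (∀ k, v k ∈ S) ∧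
      ∀ i j, A i j = ∑ k, w k * (v k i * v k j) := by
  obtain ⟨ι, _, z, w, hz, hzi, hw, hw1, hsum⟩ := eq_pos_convex_span_of_mem_convexHull h
  choose v hvS hvz using fun k => hz (Set.mem_range_self k)
  have hzv : ∀ k i j, z k i j = v k i * v k j := fun k i j => by rw [← hvz]
  have hli : LinearIndependent ℝ
      fun k => (fun s : Sym2 (Fin b) => v k s.inf * v k s.sup) := by
    rw [Fintype.linearIndependent_iff]
    intro g hg
    have hle : ∀ i j : Fin b, i ≤ j → ∑ k, g k * (v k i * v k j) = 0 := by
      intro i j hij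
      simpa [inf_eq_left.mpr hij, sup_eq_right.mpr hij] using congrFun hg s(i, j)
    have hall : ∀ i j : Fin b, ∑ k, g k * (v k i * v k j) = 0 := by
      intro i j
      rcases le_total i j with hij | hij
      · exact hle i j hij
      · rw [← hle j i hij]
        exact Finset.sum_congr rfl fun k _ => by ring
    have hg0 : ∑ k, g k = 0 := by
      calc ∑ k, g k = ∑ k, g k * (v k ⬝ᵥ P.mulVec (v k)) :=
            Finset.sum_congr rfl fun k _ => by rw [hS _ (hvS k), mul_one]
        _ = ∑ k, ∑ i, ∑ j, P i j * (g k * (v k i * v k j)) := by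
            simp only [dotProduct, Matrix.mulVec, Finset.mul_sum]
            exact Finset.sum_congr rfl fun k _ => Finset.sum_congr rfl fun i _ =>
              Finset.sum_congr rfl fun j _ => by ring
        _ = ∑ i, ∑ j, P i j * ∑ k, g k * (v k i * v k j) := by
            rw [Finset.sum_comm]
            refine Finset.sum_congr rfl fun i _ => ?_
            rw [Finset.sum_comm]
            simp only [Finset.mul_sum]
        _ = 0 := by simp [hall]
    have hgz : ∑ k, g k • z k = 0 := by
      ext i j
      simpa [Finset.sum_apply, hzv] using hall i j
    intro k
    exact affineIndependent_iff.mp hzi Finset.univ g hg0 hgz k (Finset.mem_univ k)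
  have hcard : Fintype.card ι ≤ b * (b + 1) / 2 := by
    have := hli.fintype_card_le_finrank
    rwa [Module.finrank_fintype_fun_eq_card, Sym2.card, Fintype.card_fin, Nat.choose_two_right,
      Nat.add_sub_cancel, mul_comm] at this
  let e := (Fintype.equivFin ι).symm
  refine ⟨Fintype.card ι, hcard, w ∘ e, v ∘ e, fun k => hw _, ?_, fun k => hvS _, fun i j => ?_⟩
  · rw [← hw1]; exact e.sum_comp w
  · have := congrFun (congrFun hsum i) j
    simp only [Finset.sum_apply, Pi.smul_apply, smul_eq_mul, hzv] at this
    rw [← this]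
    exact (e.sum_comp fun k => w k * (v k i * v k j)).symm

theorem IsJohnMatrix.posDef {b : ℕ} {nrm : (Fin b → ℝ) → ℝ} {Q : Matrix (Fin b) (Fin b) ℝ}
    (hQ : IsJohnMatrix nrm Q) : Q.PosDef :=
  Matrix.PosDef.of_dotProduct_mulVec_pos (by simpa [Matrix.IsHermitian] using hQ.1.eq)
    fun {x} hx => by simpa using hQ.2.1 x hx

open Filter Topology in
/-- No symmetric direction strictly increases the volume of the John ellipsoid while decreasing
its support function at all contact points. -/
theorem IsJohnMatrix.trace_mul_nonpos {b : ℕ} {nrm : Seminorm ℝ (Fin b → ℝ)}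
    {Q H : Matrix (Fin b) (Fin b) ℝ} (hQ : IsJohnMatrix (fun x => nrm x) Q) (hH : H.IsSymm)
    (hneg : ∀ v ∈ polarBody nrm, v ⬝ᵥ Q⁻¹.mulVec v = 1 → v ⬝ᵥ H.mulVec v < 0) :
    (Q * H).trace ≤ 0 := by
  by_contra! htr
  have hQP := hQ.posDef
  have hunit : IsUnit Q.det := hQP.det_pos.ne'.isUnit
  have hle : ∀ v ∈ polarBody nrm, v ⬝ᵥ Q⁻¹.mulVec v ≤ 1 := fun v hv =>
    dotProduct_mulVec_le_one_of_mem_polarBody (Matrix.mul_nonsing_inv _ hunit) hQ.2.2.1 hv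
  have hdet := eventually_det_lt_det_add_smul (Matrix.nonsing_inv_mul _ hunit)
    hQP.inv.det_pos htr
  have hpd : ∀ᶠ ε : ℝ in 𝓝[>] 0, (Q⁻¹ + ε • H).PosDef :=
    (hQP.inv.eventually_add_smul hH).filter_mono nhdsWithin_le_nhds
  have hclosed : IsClosed {v : Fin b → ℝ | 0 ≤ v ⬝ᵥ H.mulVec v} :=
    isClosed_le continuous_const (by fun_prop)
  have hfar := ((isCompact_polarBody nrm).inter_right hclosed).eventually_pos_add_mul
    (p := fun v => 1 - v ⬝ᵥ Q⁻¹.mulVec v) (h := fun v => -(v ⬝ᵥ H.mulVec v))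
    (by fun_prop) (by fun_prop) (fun v hv => by
      have hne : v ⬝ᵥ Q⁻¹.mulVec v ≠ 1 := fun h => (hneg v hv.1 h).not_ge hv.2
      exact sub_pos.mpr (lt_of_le_of_ne (hle v hv.1) hne))
  obtain ⟨ε, hε, hεpd, hεfar, hεpos⟩ := (hdet.and (hpd.and
    ((hfar.filter_mono nhdsWithin_le_nhds).and self_mem_nhdsWithin))).exists
  have hεpos : 0 < ε := hεpos
  have hbound : ∀ v ∈ polarBody nrm, v ⬝ᵥ (Q⁻¹ + ε • H).mulVec v ≤ 1 := by
    intro v hv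
    simp only [Matrix.add_mulVec, Matrix.smul_mulVec, dotProduct_add, dotProduct_smul, smul_eq_mul]
    rcases le_or_gt 0 (v ⬝ᵥ H.mulVec v) with h | h
    · linarith [hεfar v ⟨hv, h⟩]
    · nlinarith [hle v hv]
  have hunit' : IsUnit (Q⁻¹ + ε • H).det := hεpd.det_pos.ne'.isUnit
  have hmin := hQ.2.2.2 (Q⁻¹ + ε • H)⁻¹
    (by simpa [Matrix.IsHermitian, Matrix.IsSymm] using hεpd.inv.isHermitian)
    (fun x hx => by simpa using hεpd.inv.dotProduct_mulVec_pos hx)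
    (norm_le_one_of_forall_polarBody hεpd (Matrix.mul_nonsing_inv _ hunit') hbound)
  have h1 : Q⁻¹.det * Q.det = 1 := by
    rw [← Matrix.det_mul, Matrix.nonsing_inv_mul _ hunit, Matrix.det_one]
  have h2 : (Q⁻¹ + ε • H).det * (Q⁻¹ + ε • H)⁻¹.det = 1 := by
    rw [← Matrix.det_mul, Matrix.mul_nonsing_inv _ hunit', Matrix.det_one]
  have h3 := mul_lt_mul_of_pos_right hε hQP.det_pos
  have h4 := mul_le_mul_of_nonneg_left hmin hεpd.det_pos.le
  linarith

/-- A contact functional of an ellipsoid inscribed in the unit ball has dual norm one. -/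
theorem dualNorm_eq_one_of_mem_polarBody {b : ℕ} {nrm : Seminorm ℝ (Fin b → ℝ)}
    {P Q : Matrix (Fin b) (Fin b) ℝ} (hPQ : Q * P = 1)
    (h : ∀ x, x ⬝ᵥ Q.mulVec x ≤ 1 → nrm x ≤ 1) {v : Fin b → ℝ} (hv : v ∈ polarBody nrm)
    (hv1 : v ⬝ᵥ P.mulVec v = 1) :
    dualNorm (fun x => nrm x) (dotProductBilin ℝ ℝ v) = 1 := by
  refine IsGreatest.csSup_eq ⟨⟨P.mulVec v, h _ ?_, ?_⟩, ?_⟩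
  · rw [Matrix.mulVec_mulVec, hPQ, Matrix.one_mulVec, dotProduct_comm, hv1]
  · simp [hv1]
  · rintro _ ⟨x, hx, rfl⟩
    exact (hv x).trans hx

/-- **Decomposition of the John–Euclidean norm into rank-one forms** (Lemma 4.2).
Let `(V, ‖·‖)` be a `b`-dimensional real Banach space (in coordinates, `ℝᵇ` with a
norm `nrm`), and let `‖·‖_E` be the Euclidean norm determined by the John ellipsoid of
the unit ball of `nrm` (encoded by a matrix `Q`, so `‖·‖_E = johnNorm Q`).  Then there
exist `N ≤ b(b+1)/2`, reals `λ₁, …, λ_N > 0` with `∑ λᵢ = b`, and linear functionals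
`L₁, …, L_N : V → ℝ` with `‖Lᵢ‖* = 1` (for the norm dual to `nrm`), such that
`‖x‖_E² = ∑ᵢ λᵢ Lᵢ(x)²` for all `x ∈ V`. -/
theorem john_ellipsoid_decomposition
    (b : ℕ) (hb : 0 < b)
    (nrm : Seminorm ℝ (Fin b → ℝ))            -- the norm `‖·‖` of the Banach space
    (hdef : ∀ x, nrm x = 0 → x = 0)           -- `‖·‖` is a norm
    (Q : Matrix (Fin b) (Fin b) ℝ)
    (hQ : IsJohnMatrix (fun x => nrm x) Q)    -- `‖·‖_E = johnNorm Q`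
    : ∃ (N : ℕ), N ≤ b * (b + 1) / 2 ∧
        ∃ (lam : Fin N → ℝ) (L : Fin N → (Fin b → ℝ) →ₗ[ℝ] ℝ),
          (∀ i, 0 < lam i) ∧
          (∑ i, lam i = (b : ℝ)) ∧
          (∀ i, dualNorm (fun x => nrm x) (L i) = 1) ∧
          ∀ x : Fin b → ℝ, johnNorm Q x ^ 2 = ∑ i, lam i * L i x ^ 2 := by
  have hQP := hQ.posDef
  have hunit : IsUnit Q.det := hQP.det_pos.ne'.isUnit
  have hQQ := Matrix.mul_nonsing_inv _ hunit
  have hb' : (0 : ℝ) < b := Nat.cast_pos.mpr hb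
  set S : Set (Fin b → ℝ) := polarBody nrm ∩ {v | v ⬝ᵥ Q⁻¹.mulVec v = 1}
  have hS : IsCompact S :=
    (isCompact_polarBody nrm).inter_right (isClosed_eq (by fun_prop) continuous_const)
  have hmem : (fun i j => ((b : ℝ)⁻¹ • Q) i j) ∈
      convexHull ℝ ((fun (v : Fin b → ℝ) i j => v i * v j) '' S) := by
    by_contra hnot
    obtain ⟨H, u, hH, hHS, hu⟩ := exists_isSymm_separating hS (hQ.1.smul _) hnot
    have hPsymm : (Q⁻¹).IsSymm := by
      simpa [Matrix.IsHermitian, Matrix.IsSymm] using hQP.inv.isHermitian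
    have hle := hQ.trace_mul_nonpos (H := H - u • Q⁻¹) (hH.sub (hPsymm.smul u)) fun v hv hv1 => by
      rw [Matrix.sub_mulVec, Matrix.smul_mulVec, dotProduct_sub, dotProduct_smul, hv1,
        smul_eq_mul, mul_one]
      exact sub_neg.mpr (hHS v ⟨hv, hv1⟩)
    rw [mul_sub, mul_smul_comm, hQQ, Matrix.trace_sub, Matrix.trace_smul, Matrix.trace_one,
      Fintype.card_fin, smul_eq_mul] at hle
    rw [smul_mul_assoc, Matrix.trace_smul, smul_eq_mul, inv_mul_eq_div, lt_div_iff₀ hb'] at hu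
    linarith
  obtain ⟨N, hN, w, v, hw, hw1, hvS, hsum⟩ :=
    exists_fin_sum_squares_of_mem_convexHull (fun v hv => hv.2) hmem
  refine ⟨N, hN, fun k => b * w k, fun k => dotProductBilin ℝ ℝ (v k), fun k => mul_pos hb' (hw k),
    by rw [← Finset.mul_sum, hw1, mul_one],
    fun k => dualNorm_eq_one_of_mem_polarBody hQQ hQ.2.2.1 (hvS k).1 (hvS k).2, fun x => ?_⟩
  have hnn : 0 ≤ x ⬝ᵥ Q.mulVec x := by simpa using hQP.posSemidef.dotProduct_mulVec_nonneg x
  have hQij : ∀ i j, Q i j = ∑ k, b * w k * (v k i * v k j) := by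
    intro i j
    have := hsum i j
    rw [Matrix.smul_apply, smul_eq_mul, inv_mul_eq_iff_eq_mul₀ hb'.ne'] at this
    rw [this, Finset.mul_sum]
    exact Finset.sum_congr rfl fun k _ => by ring
  rw [johnNorm, Real.sq_sqrt hnn]
  calc x ⬝ᵥ Q.mulVec x = ∑ i, ∑ j, ∑ k, b * w k * ((v k i * x i) * (v k j * x j)) := by
        simp only [dotProduct, Matrix.mulVec, hQij, Finset.mul_sum, Finset.sum_mul]
        exact Finset.sum_congr rfl fun i _ => Finset.sum_congr rfl fun j _ =>
          Finset.sum_congr rfl fun k _ => by ring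
    _ = ∑ k, ∑ i, ∑ j, b * w k * ((v k i * x i) * (v k j * x j)) := by
        rw [Finset.sum_comm (s := Finset.univ (α := Fin N))]
        exact Finset.sum_congr rfl fun i _ => Finset.sum_comm
    _ = ∑ k, b * w k * dotProductBilin ℝ ℝ (v k) x ^ 2 := by
        refine Finset.sum_congr rfl fun k _ => ?_
        rw [dotProductBilin_apply_apply, dotProduct, sq, Finset.sum_mul_sum]
        simp only [Finset.mul_sum]
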